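/- There exists a constant C > 0 with the following property. Let A and B be bounded self-adjoint operators on a complex Hilbert space H, let R be a bounded linear operator on H with ‖R‖ ≤ 1, and set ε := ‖A·R − R·B‖, assuming ε > 0. Let 𝔉 be a closed subset of ℝ with σ(A) ⊆ 𝔉, and let Λ ⊂ ℝ be a finite nonempty set which is an ε-net of 𝔉, i.e., 𝔉 ⊆ ⋃_{t ∈ Λ} [t − ε, t + ε]. Let L ≥ 0 and let f : ℝ → ℂ be a continuous function satisfying |f(x) − f(y)| ≤ L·|x − y| for all x, y in 𝔉 ∪ σ(B). Then ‖f(A)·R − R·f(B)‖ ≤ C · (1 + log(card Λ)) · L · ‖A·R − R·B‖. -/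

import Mathlib

open MeasureTheory ENNReal

/-- `|T| = (T*T)^{1/2}` via the continuous functional calculus. -/
noncomputable def opAbs {H : Type} [NormedAddCommGroup H] [InnerProductSpace ℂ H]
    [CompleteSpace H] (T : H →L[ℂ] H) : H →L[ℂ] H :=
  cfc Real.sqrt (star T * T)

/-- The Hilbert space `ℓ²(ℕ, ℂ)`. -/
noncomputable abbrev ellTwo : Type := lp (fun _ : ℕ => ℂ) 2

/-- Application of a function `f : ℝ → ℂ` to a (self-adjoint) operator via the
continuous functional calculus. -/
noncomputable def cfcC {H : Type} [NormedAddCommGroup H] [InnerProductSpace ℂ H]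
    [CompleteSpace H] (f : ℝ → ℂ) (A : H →L[ℂ] H) : H →L[ℂ] H :=
  cfc (fun z : ℂ => f z.re) A

lemma sum_sub_le_of_ordered {S : Finset ℕ} {lo hi : ℕ → ℝ} {G : ℝ → ℝ} (hG : Monotone G)
    (hG1 : ∀ t, -1 ≤ G t) (hlt : ∀ k ∈ S, ∀ k' ∈ S, k < k' → hi k ≤ lo k') {b : ℝ}
    (hb : ∀ k ∈ S, hi k ≤ b) : ∑ k ∈ S, (G (hi k) - G (lo k)) ≤ G b + 1 := by
  induction S using Finset.induction_on_max generalizing b with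
  | empty => simpa using by linarith [hG1 b]
  | insert a S ha ih =>
    rw [Finset.sum_insert (fun h => lt_irrefl _ (ha a h))]
    have h1 := ih (b := lo a)
      (fun k hk k' hk' h => hlt k (Finset.mem_insert_of_mem hk) k' (Finset.mem_insert_of_mem hk') h)
      (fun k hk => hlt k (Finset.mem_insert_of_mem hk) a (Finset.mem_insert_self _ _) (ha k hk))
    have h2 := hG (hb a (Finset.mem_insert_self _ _))
    linarith

lemma monotone_div_add_abs {l : ℝ} (hl : 0 < l) (x : ℝ) :
    Monotone fun t : ℝ => (t - x) / (l + |t - x|) := by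
  intro s t hst
  have h1 : 0 < l + |s - x| := by positivity
  have h2 : 0 < l + |t - x| := by positivity
  simp only
  rw [div_le_div_iff₀ h1 h2]
  have : (s - x) * l ≤ (t - x) * l := by gcongr
  rcases abs_cases (s - x) with ⟨e, h⟩ | ⟨e, h⟩ <;> rcases abs_cases (t - x) with ⟨e', h'⟩ | ⟨e', h'⟩ <;>
    rw [e, e'] <;> nlinarith

lemma sq_div_le_sub {l x y lo hi : ℝ} (hl : 0 < l) (hlo : lo ≤ y) (hhi : y ≤ hi)
    (hlen : l ≤ hi - lo) (hx : x ≤ lo ∨ hi ≤ x) :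
    l ^ 2 / (l + |x - y|) ^ 2 ≤
      2 * ((hi - x) / (l + |hi - x|) - (lo - x) / (l + |lo - x|)) := by
  rcases hx with hx | hx
  · have h1 : (lo + l - x) / (l + |lo + l - x|) ≤ (hi - x) / (l + |hi - x|) :=
      monotone_div_add_abs hl x (by linarith)
    have h2 : l ^ 2 / (l + |x - y|) ^ 2 ≤ l ^ 2 / (l + (lo - x)) ^ 2 := by
      rw [abs_of_nonpos (by linarith)]
      have : 0 ≤ lo - x := by linarith
      gcongr
      linarith
    rw [abs_of_nonneg (by linarith : 0 ≤ lo + l - x)] at h1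
    rw [abs_of_nonneg (by linarith : 0 ≤ lo - x)]
    obtain ⟨s, hs⟩ : ∃ s, s = lo - x := ⟨_, rfl⟩
    have hs0 : 0 ≤ s := by linarith
    rw [show lo + l - x = s + l by linarith] at h1
    rw [← hs] at h2 ⊢
    have h3 : l ^ 2 / (l + s) ^ 2 ≤ 2 * ((s + l) / (l + (s + l)) - s / (l + s)) := by
      rw [div_sub_div _ _ (by positivity) (by positivity), ← mul_div_assoc,
        div_le_div_iff₀ (by positivity) (by positivity)]
      have : 0 ≤ l ^ 2 * (l + s) * s := by positivity
      nlinarith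
    linarith
  · have h1 : (lo - x) / (l + |lo - x|) ≤ (hi - l - x) / (l + |hi - l - x|) :=
      monotone_div_add_abs hl x (by linarith)
    have h2 : l ^ 2 / (l + |x - y|) ^ 2 ≤ l ^ 2 / (l + (x - hi)) ^ 2 := by
      rw [abs_of_nonneg (by linarith)]
      have : 0 ≤ x - hi := by linarith
      gcongr
    rw [abs_of_nonpos (by linarith : hi - l - x ≤ 0)] at h1
    rw [abs_of_nonpos (by linarith : hi - x ≤ 0)]
    obtain ⟨s, hs⟩ : ∃ s, s = x - hi := ⟨_, rfl⟩
    have hs0 : 0 ≤ s := by linarith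
    rw [show hi - l - x = -(s + l) by linarith] at h1
    rw [← hs] at h2
    rw [show hi - x = -s by linarith]
    have h3 : l ^ 2 / (l + s) ^ 2 ≤ 2 * ((s + l) / (l + (s + l)) - s / (l + s)) := by
      rw [div_sub_div _ _ (by positivity) (by positivity), ← mul_div_assoc,
        div_le_div_iff₀ (by positivity) (by positivity)]
      have : 0 ≤ l ^ 2 * (l + s) * s := by positivity
      nlinarith
    rw [neg_neg, neg_div] at h1 ⊢
    linarith

/-- A partition of finitely many weighted points of the line into few order-convex classes: a class
with two distinct points is light. -/
lemma exists_classes {α : Type*} [Fintype α] (z w : α → ℝ) (hw : ∀ a, 0 ≤ w a)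
    (hw2 : ∑ a, w a ≤ 2) {m : ℕ} (hm : 0 < m) :
    ∃ c : α → ℕ, (∀ a, c a < 4 * m + 1) ∧ (∀ a b, z a ≤ z b → c a ≤ c b) ∧
      ∀ a b, c a = c b → z a < z b → ∑ d with c d = c a, w d ≤ 1 / m := by
  classical
  have hm' : (0 : ℝ) < m := by exact_mod_cast hm
  let P : ℝ → ℝ := fun s => ∑ d with z d < s, w d
  let Q : ℝ → ℝ := fun s => ∑ d with z d ≤ s, w d
  have hP0 : ∀ s, 0 ≤ P s := fun s => Finset.sum_nonneg fun d _ => hw d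
  have hQ0 : ∀ s, 0 ≤ Q s := fun s => Finset.sum_nonneg fun d _ => hw d
  have hPm : Monotone P := fun s t h => Finset.sum_le_sum_of_subset_of_nonneg
    (fun d => by simp only [Finset.mem_filter_univ]; intro h'; linarith) (fun d _ _ => hw d)
  have hQm : Monotone Q := fun s t h => Finset.sum_le_sum_of_subset_of_nonneg
    (fun d => by simp only [Finset.mem_filter_univ]; intro h'; linarith) (fun d _ _ => hw d)
  have hP2 : ∀ s, P s ≤ 2 := fun s => (Finset.sum_le_sum_of_subset_of_nonneg
    (Finset.subset_univ _) (fun d _ _ => hw d)).trans hw2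
  have hQ2 : ∀ s, Q s ≤ 2 := fun s => (Finset.sum_le_sum_of_subset_of_nonneg
    (Finset.subset_univ _) (fun d _ _ => hw d)).trans hw2
  have hQP : ∀ s t, s < t → Q s ≤ P t := fun s t h => Finset.sum_le_sum_of_subset_of_nonneg
    (fun d => by simp only [Finset.mem_filter_univ]; intro h'; linarith) (fun d _ _ => hw d)
  have hfl : ∀ r : ℝ, r ≤ 2 → ⌊m * r⌋₊ ≤ 2 * m := fun r hr => by
    rw [show 2 * m = ⌊((2 * m : ℕ) : ℝ)⌋₊ from (Nat.floor_natCast _).symm]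
    apply Nat.floor_le_floor
    push_cast
    nlinarith
  have hPf : ∀ s t, s ≤ t → ⌊m * P s⌋₊ ≤ ⌊m * P t⌋₊ := fun s t h =>
    Nat.floor_le_floor (by gcongr; exact hPm h)
  have hQf : ∀ s t, s ≤ t → ⌊m * Q s⌋₊ ≤ ⌊m * Q t⌋₊ := fun s t h =>
    Nat.floor_le_floor (by gcongr; exact hQm h)
  have hQPf : ∀ s t, s < t → ⌊m * Q s⌋₊ ≤ ⌊m * P t⌋₊ := fun s t h =>
    Nat.floor_le_floor (by gcongr; exact hQP s t h)
  refine ⟨fun a => ⌊m * P (z a)⌋₊ + ⌊m * Q (z a)⌋₊, fun a => ?_, fun a b h => ?_, ?_⟩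
  · have := hfl _ (hP2 (z a))
    have := hfl _ (hQ2 (z a))
    simp only
    omega
  · exact add_le_add (hPf _ _ h) (hQf _ _ h)
  · intro a b hab hlt
    simp only at hab
    set T := (Finset.univ.filter fun d => ⌊m * P (z d)⌋₊ + ⌊m * Q (z d)⌋₊ =
      ⌊m * P (z a)⌋₊ + ⌊m * Q (z a)⌋₊) with hT
    have haT : a ∈ T := by simp [hT]
    have hbT : b ∈ T := by simp [hT, hab]
    obtain ⟨p, hp, hpmin⟩ := T.exists_min_image z ⟨a, haT⟩
    obtain ⟨q, hq, hqmax⟩ := T.exists_max_image z ⟨a, haT⟩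
    have hpq : z p < z q := (hpmin a haT).trans_lt (hlt.trans_le (hqmax b hbT))
    have hsub : ∑ d ∈ T, w d + P (z p) ≤ Q (z q) := by
      rw [← Finset.sum_union]
      · refine Finset.sum_le_sum_of_subset_of_nonneg (fun d hd => ?_) (fun d _ _ => hw d)
        simp only [Finset.mem_filter_univ]
        rcases Finset.mem_union.1 hd with h | h
        · exact hqmax d h
        · simp only [Finset.mem_filter_univ] at h
          linarith
      · rw [Finset.disjoint_left]
        intro d hd h
        simp only [Finset.mem_filter_univ] at h
        exact absurd (hpmin d hd) (not_le.2 h)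
    have hp' : ⌊m * P (z p)⌋₊ + ⌊m * Q (z p)⌋₊ = ⌊m * P (z a)⌋₊ + ⌊m * Q (z a)⌋₊ := by
      simpa [hT] using hp
    have hq' : ⌊m * P (z q)⌋₊ + ⌊m * Q (z q)⌋₊ = ⌊m * P (z a)⌋₊ + ⌊m * Q (z a)⌋₊ := by
      simpa [hT] using hq
    have h1 := hPf _ _ hpq.le
    have h2 := hQf _ _ hpq.le
    have h3 := hQPf _ _ hpq
    have h4 : ⌊m * Q (z q)⌋₊ ≤ ⌊m * P (z p)⌋₊ := by omega
    have h5 := Nat.lt_floor_add_one ((m : ℝ) * Q (z q))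
    have h6 := Nat.floor_le (mul_nonneg hm'.le (hP0 (z p)))
    have h7 : ((⌊m * Q (z q)⌋₊ : ℕ) : ℝ) ≤ (⌊m * P (z p)⌋₊ : ℕ) := by exact_mod_cast h4
    rw [le_div_iff₀ hm']
    nlinarith

/-- Summation over the classes not shorter than the class of `a`. -/
lemma sum_weight_mul_le {α : Type*} [Fintype α] (z w : α → ℝ) (hw : ∀ a, 0 ≤ w a) {m : ℕ}
    (hm : 0 < m) (c : α → ℕ) (hc : ∀ a b, z a ≤ z b → c a ≤ c b)
    (hlight : ∀ a b, c a = c b → z a < z b → ∑ d with c d = c a, w d ≤ 1 / m)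
    (lo hi : ℕ → ℝ) (hlo : ∀ a, ∃ b, c b = c a ∧ z b = lo (c a))
    (hhi : ∀ a, ∃ b, c b = c a ∧ z b = hi (c a))
    (hlz : ∀ a, lo (c a) ≤ z a) (hzh : ∀ a, z a ≤ hi (c a)) (a : α)
    {l : ℝ} (hl0 : 0 < l) :
    ∑ b with l ≤ hi (c b) - lo (c b), w b * (l ^ 2 / (l + |z a - z b|) ^ 2) ≤ 5 / m := by
  classical
  have hm' : (0 : ℝ) < m := by exact_mod_cast hm
  set U := Finset.univ.filter fun b => l ≤ hi (c b) - lo (c b) with hU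
  set S := U.image c with hS
  set G : ℝ → ℝ := fun t => (t - z a) / (l + |t - z a|) with hGdef
  have hG : Monotone G := monotone_div_add_abs hl0 (z a)
  have habs : ∀ t, |G t| ≤ 1 := fun t => by
    rw [hGdef]
    simp only
    rw [abs_div, abs_of_pos (by positivity : 0 < l + |t - z a|), div_le_one (by positivity)]
    linarith
  have hord : ∀ p q, c p < c q → z p < z q := fun p q h => by
    by_contra! h'
    exact absurd (hc _ _ h') (not_le.2 h)
  have hclass : ∀ k ∈ S, ∑ b ∈ U with c b = k, w b * (l ^ 2 / (l + |z a - z b|) ^ 2) ≤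
      1 / m * ((if k = c a then 1 else 0) + 2 * (G (hi k) - G (lo k))) := by
    intro k hk
    obtain ⟨d, hd, rfl⟩ := Finset.mem_image.1 hk
    have hlen : l ≤ hi (c d) - lo (c d) := by simpa [hU] using hd
    obtain ⟨p, hpc, hp⟩ := hlo d
    obtain ⟨q, hqc, hq⟩ := hhi d
    have hmass := hlight p q (hpc.trans hqc.symm) (by rw [hp, hq]; linarith)
    rw [hpc] at hmass
    have hGk : 0 ≤ G (hi (c d)) - G (lo (c d)) := sub_nonneg.2 (hG (by linarith))
    have hE : ∀ b ∈ U.filter (fun b => c b = c d), l ^ 2 / (l + |z a - z b|) ^ 2 ≤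
        (if c d = c a then 1 else 0) + 2 * (G (hi (c d)) - G (lo (c d))) := by
      intro b hb
      have hbc : c b = c d := (Finset.mem_filter.1 hb).2
      split_ifs with h
      · have : l ^ 2 / (l + |z a - z b|) ^ 2 ≤ 1 := by
          rw [div_le_one (by positivity)]
          have := abs_nonneg (z a - z b)
          gcongr
          linarith
        linarith
      · rw [zero_add]
        refine sq_div_le_sub hl0 (hbc ▸ hlz b) (hbc ▸ hzh b) hlen ?_
        rcases lt_or_gt_of_ne h with h | h
        · right
          rw [← hq]
          exact (hord _ _ (hqc ▸ h)).le
        · left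
          rw [← hp]
          exact (hord _ _ (hpc ▸ h)).le
    calc _ ≤ ∑ b ∈ U with c b = c d, w b *
          ((if c d = c a then 1 else 0) + 2 * (G (hi (c d)) - G (lo (c d)))) :=
          Finset.sum_le_sum fun b hb => mul_le_mul_of_nonneg_left (hE b hb) (hw b)
      _ = (∑ b ∈ U with c b = c d, w b) *
          ((if c d = c a then 1 else 0) + 2 * (G (hi (c d)) - G (lo (c d)))) := by
          rw [Finset.sum_mul]
      _ ≤ _ := by
          refine mul_le_mul_of_nonneg_right (le_trans ?_ hmass) (by split_ifs <;> linarith)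
          exact Finset.sum_le_sum_of_subset_of_nonneg
            (Finset.filter_subset_filter _ (Finset.subset_univ _)) (fun b _ _ => hw b)
  have htel : ∑ k ∈ S, (G (hi k) - G (lo k)) ≤ 2 := by
    obtain ⟨B, hB⟩ := (S.finite_toSet.image hi).bddAbove
    have := sum_sub_le_of_ordered (S := S) (lo := lo) (hi := hi) hG (fun t => (abs_le.1 (habs t)).1)
      (b := B) (fun k hk k' hk' h => ?_) (fun k hk => hB ⟨k, hk, rfl⟩)
    · linarith [(abs_le.1 (habs B)).2]
    · obtain ⟨d, -, rfl⟩ := Finset.mem_image.1 hk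
      obtain ⟨d', -, rfl⟩ := Finset.mem_image.1 hk'
      obtain ⟨q, hqc, hq⟩ := hhi d
      obtain ⟨p, hpc, hp⟩ := hlo d'
      rw [← hq, ← hp]
      exact (hord _ _ (by rw [hqc, hpc]; exact h)).le
  have hone : ∑ k ∈ S, (if k = c a then (1 : ℝ) else 0) ≤ 1 := by
    rw [Finset.sum_ite_eq']
    split_ifs <;> norm_num
  calc _ = ∑ k ∈ S, ∑ b ∈ U with c b = k, w b * (l ^ 2 / (l + |z a - z b|) ^ 2) :=
        (Finset.sum_fiberwise_of_maps_to (fun b hb => Finset.mem_image_of_mem c hb) _).symm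
    _ ≤ ∑ k ∈ S, 1 / m * ((if k = c a then 1 else 0) + 2 * (G (hi k) - G (lo k))) :=
        Finset.sum_le_sum hclass
    _ = 1 / m * (∑ k ∈ S, (if k = c a then (1 : ℝ) else 0) +
          2 * ∑ k ∈ S, (G (hi k) - G (lo k))) := by
        rw [← Finset.mul_sum, Finset.sum_add_distrib, Finset.mul_sum (a := (2 : ℝ))]
    _ ≤ 1 / m * 5 := by
        gcongr
        linarith
    _ = 5 / m := by ring

/-- The divided difference of `f`, equal to `0` on the diagonal. -/
noncomputable def divDiff (f : ℝ → ℂ) (s t : ℝ) : ℂ := (f s - f t) / ((s - t : ℝ) : ℂ)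

lemma norm_divDiff_le {f : ℝ → ℂ} {L : ℝ} (hL : 0 ≤ L) {s t : ℝ}
    (h : ‖f s - f t‖ ≤ L * |s - t|) : ‖divDiff f s t‖ ≤ L := by
  rw [divDiff, norm_div, Complex.norm_real, Real.norm_eq_abs]
  exact div_le_of_le_mul₀ (abs_nonneg _) hL h

lemma divDiff_comm (f : ℝ → ℂ) (s t : ℝ) : divDiff f s t = divDiff f t s := by
  rw [divDiff, divDiff, ← neg_sub (f t), ← neg_sub t s, Complex.ofReal_neg, neg_div_neg_eq]

lemma norm_divDiff_sub_le {f : ℝ → ℂ} {L : ℝ} (hL : 0 ≤ L) {r s t l : ℝ}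
    (hst : ‖f s - f t‖ ≤ L * |s - t|) (hrt : ‖f r - f t‖ ≤ L * |r - t|)
    (hsr : ‖f s - f r‖ ≤ L * |s - r|) (hs : s ≠ t) (hr : r ≠ t) (hl : |s - r| ≤ l) :
    ‖divDiff f s t - divDiff f r t‖ * (l + |s - t|) ≤ 4 * L * l := by
  have h1 : ‖divDiff f s t - divDiff f r t‖ ≤ 2 * L := by
    refine (norm_sub_le _ _).trans ?_
    linarith [norm_divDiff_le hL hst, norm_divDiff_le hL hrt]
  have hs' : ((s - t : ℝ) : ℂ) ≠ 0 := by exact_mod_cast sub_ne_zero.2 hs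
  have hr' : ((r - t : ℝ) : ℂ) ≠ 0 := by exact_mod_cast sub_ne_zero.2 hr
  have h2 : (divDiff f s t - divDiff f r t) * ((s - t : ℝ) : ℂ) =
      (f s - f r) - divDiff f r t * ((s - r : ℝ) : ℂ) := by
    rw [divDiff, divDiff]
    field_simp
    push_cast
    ring
  have h3 : ‖divDiff f s t - divDiff f r t‖ * |s - t| ≤ 2 * L * l := by
    rw [← Real.norm_eq_abs, ← Complex.norm_real, ← norm_mul, h2]
    refine (norm_sub_le _ _).trans ?_
    rw [norm_mul, Complex.norm_real, Real.norm_eq_abs]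
    have h4 := norm_divDiff_le hL hrt
    have h5 : ‖divDiff f r t‖ * |s - r| ≤ L * l := by gcongr
    have h6 : L * |s - r| ≤ L * l := by gcongr
    linarith
  have h7 : 0 ≤ l := (abs_nonneg _).trans hl
  nlinarith

lemma norm_sum_mul_le_of_factorization {ι κ γ : Type*} [Fintype ι] [Fintype κ] [Fintype γ]
    {t M : ι → κ → ℂ} {c : ℝ} (hc : 0 ≤ c)
    (ht : ∀ (p : ι → ℂ) (q : κ → ℂ),
      ‖∑ i, ∑ j, t i j * (p i * q j)‖ ≤ c * √(∑ i, ‖p i‖ ^ 2) * √(∑ j, ‖q j‖ ^ 2))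
    (p : γ → ι → ℂ) (q : γ → κ → ℂ) (hM : ∀ i j, M i j = ∑ k, p k i * q k j) :
    ‖∑ i, ∑ j, t i j * M i j‖ ≤ c * √(Fintype.card γ) * √(∑ i, ∑ j, ‖M i j‖ ^ 2) := by
  classical
  let P : γ → EuclideanSpace ℂ ι := fun k => WithLp.toLp 2 (p k)
  let S := Submodule.span ℂ (Set.range P)
  let N := Module.finrank ℂ S
  have hN : N ≤ Fintype.card γ := finrank_range_le_card P
  let e := stdOrthonormalBasis ℂ S
  let C : κ → S := fun j => ⟨∑ k, q k j • P k,
    Submodule.sum_mem _ fun k _ => Submodule.smul_mem _ _ (Submodule.subset_span ⟨k, rfl⟩)⟩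
  have hC : ∀ i j, (C j : EuclideanSpace ℂ ι) i = M i j := fun i j => by
    simp [C, P, hM, mul_comm]
  let W : Fin N → κ → ℂ := fun k j => inner ℂ (e k) (C j)
  have hdec : ∀ i j, M i j = ∑ k, (e k : EuclideanSpace ℂ ι) i * W k j := fun i j => by
    have h1 := congrArg (fun v : S => (v : EuclideanSpace ℂ ι) i) (e.sum_repr' (C j))
    simp only [hC] at h1
    rw [← h1]
    simp [W, mul_comm]
  have hparse : ∑ k, ∑ j, ‖W k j‖ ^ 2 = ∑ i, ∑ j, ‖M i j‖ ^ 2 := by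
    rw [Finset.sum_comm, Finset.sum_comm (s := (Finset.univ : Finset ι))]
    refine Finset.sum_congr rfl fun j _ => ?_
    rw [e.sum_sq_norm_inner_right (C j), Submodule.coe_norm, EuclideanSpace.norm_sq_eq]
    simp [hC]
  have hek : ∀ k, ∑ i, ‖(e k : EuclideanSpace ℂ ι) i‖ ^ 2 = 1 := fun k => by
    rw [← EuclideanSpace.norm_sq_eq, ← Submodule.coe_norm, e.norm_eq_one]
    norm_num
  have hsum : ∑ i, ∑ j, t i j * M i j =
      ∑ k, ∑ i, ∑ j, t i j * ((e k : EuclideanSpace ℂ ι) i * W k j) := by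
    simp_rw [hdec, Finset.mul_sum]
    rw [Finset.sum_comm (t := (Finset.univ : Finset ι))]
    exact Finset.sum_congr rfl fun i _ => Finset.sum_comm
  rw [hsum]
  calc _ ≤ ∑ k, ‖∑ i, ∑ j, t i j * ((e k : EuclideanSpace ℂ ι) i * W k j)‖ := norm_sum_le _ _
    _ ≤ ∑ k : Fin N, c * √(∑ j, ‖W k j‖ ^ 2) := Finset.sum_le_sum fun k _ => by
        simpa [hek] using ht (fun i => (e k : EuclideanSpace ℂ ι) i) (W k)
    _ = c * ∑ k : Fin N, 1 * √(∑ j, ‖W k j‖ ^ 2) := by simp [Finset.mul_sum]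
    _ ≤ c * (√(∑ k : Fin N, 1 ^ 2) * √(∑ k : Fin N, √(∑ j, ‖W k j‖ ^ 2) ^ 2)) := by
        gcongr
        exact Real.sum_mul_le_sqrt_mul_sqrt _ _ _
    _ ≤ c * √(Fintype.card γ) * √(∑ i, ∑ j, ‖M i j‖ ^ 2) := by
        rw [mul_assoc]
        gcongr
        · simpa using hN
        · rw [← hparse]
          exact le_of_eq (Finset.sum_congr rfl fun k _ => Real.sq_sqrt (by positivity))

lemma norm_sq_sub_le {z L l d : ℝ} (hl : 0 < l) (hd : 0 ≤ d) (hz : 0 ≤ z)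
    (h : z * (l + d) ≤ 4 * L * l) : z ^ 2 ≤ 16 * L ^ 2 * (l ^ 2 / (l + d) ^ 2) := by
  rw [← mul_div_assoc, le_div_iff₀ (by positivity), ← mul_pow]
  calc (z * (l + d)) ^ 2 ≤ (4 * L * l) ^ 2 := by gcongr
    _ = _ := by ring

/-- Low rank approximation of the divided difference kernel in the Hilbert–Schmidt norm. -/
lemma exists_lowRank_approx {ι κ : Type*} [Fintype ι] [Fintype κ] (x : ι → ℝ) (y : κ → ℝ)
    {f : ℝ → ℂ} {L : ℝ} (hL : 0 ≤ L)
    (hf : ∀ s ∈ Set.range x ∪ Set.range y, ∀ t ∈ Set.range x ∪ Set.range y,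
      ‖f s - f t‖ ≤ L * |s - t|)
    (u : ι → ℝ) (v : κ → ℝ) (hu : ∑ i, u i ^ 2 ≤ 1) (hv : ∑ j, v j ^ 2 ≤ 1)
    {m : ℕ} (hm : 0 < m) :
    ∃ (p : Fin (4 * m + 1) ⊕ Fin (4 * m + 1) → ι → ℂ)
      (q : Fin (4 * m + 1) ⊕ Fin (4 * m + 1) → κ → ℂ),
      ∑ i, ∑ j, ‖divDiff f (x i) (y j) * (u i * v j) - ∑ k, p k i * q k j‖ ^ 2 ≤
        160 * L ^ 2 / m := by
  classical
  have hm' : (0 : ℝ) < m := by exact_mod_cast hm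
  let z : ι ⊕ κ → ℝ := Sum.elim x y
  let w : ι ⊕ κ → ℝ := Sum.elim (fun i => u i ^ 2) (fun j => v j ^ 2)
  have hw : ∀ a, 0 ≤ w a := by rintro (i | j) <;> exact sq_nonneg _
  have hf' : ∀ a b, ‖f (z a) - f (z b)‖ ≤ L * |z a - z b| := by
    have : ∀ a, z a ∈ Set.range x ∪ Set.range y := by rintro (i | j) <;> simp [z]
    exact fun a b => hf _ (this a) _ (this b)
  obtain ⟨c, hcm, hc, hlight⟩ := exists_classes z w hw
    (by rw [Fintype.sum_sum_type]; simp only [w, Sum.elim_inl, Sum.elim_inr]; linarith) hm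
  have hlo' : ∀ k, ∃ r, ∀ a, c a = k → (∃ b, c b = k ∧ z b = r) ∧ r ≤ z a := by
    intro k
    rcases (Finset.univ.filter fun a => c a = k).eq_empty_or_nonempty with h | h
    · exact ⟨0, fun a ha => absurd ha (Finset.filter_eq_empty_iff.1 h (Finset.mem_univ a))⟩
    · obtain ⟨b, hb, hmin⟩ := Finset.exists_min_image _ z h
      exact ⟨z b, fun a ha => ⟨⟨b, by simpa using hb, rfl⟩, hmin a (by simpa using ha)⟩⟩
  have hhi' : ∀ k, ∃ r, ∀ a, c a = k → (∃ b, c b = k ∧ z b = r) ∧ z a ≤ r := by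
    intro k
    rcases (Finset.univ.filter fun a => c a = k).eq_empty_or_nonempty with h | h
    · exact ⟨0, fun a ha => absurd ha (Finset.filter_eq_empty_iff.1 h (Finset.mem_univ a))⟩
    · obtain ⟨b, hb, hmax⟩ := Finset.exists_max_image _ z h
      exact ⟨z b, fun a ha => ⟨⟨b, by simpa using hb, rfl⟩, hmax a (by simpa using ha)⟩⟩
  choose lo hlo using hlo'
  choose hi hhi using hhi'
  have hlz : ∀ a, lo (c a) ≤ z a := fun a => (hlo _ a rfl).2
  have hzh : ∀ a, z a ≤ hi (c a) := fun a => (hhi _ a rfl).2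
  have hloa : ∀ a, ∃ b, c b = c a ∧ z b = lo (c a) := fun a => (hlo _ a rfl).1
  have hhia : ∀ a, ∃ b, c b = c a ∧ z b = hi (c a) := fun a => (hhi _ a rfl).1
  let len : ι ⊕ κ → ℝ := fun a => hi (c a) - lo (c a)
  have hlen : ∀ a, 0 ≤ len a := fun a => by
    simp only [len]
    linarith [hlz a, hzh a]
  -- the squared error of replacing `z a` by the left end of its class
  let E : ι ⊕ κ → ι ⊕ κ → ℝ := fun a b =>
    if 0 < len a ∧ len a ≤ len b then len a ^ 2 / (len a + |z a - z b|) ^ 2 else 0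
  have hE0 : ∀ a b, 0 ≤ E a b := fun a b => by
    simp only [E]
    split_ifs <;> positivity
  have hEsum : ∀ a, ∑ b, w b * E a b ≤ 5 / m := by
    intro a
    rcases (hlen a).eq_or_lt with h | h
    · simp only [E, ← h, lt_irrefl, false_and, if_false, mul_zero, Finset.sum_const_zero]
      positivity
    · have := sum_weight_mul_le z w hw hm c hc hlight lo hi hloa hhia hlz hzh a h
      simpa only [E, h, true_and, mul_ite, mul_zero, Finset.sum_filter] using this
  have hfar : ∀ a b, c a ≠ c b → len a ≤ len b →
      ‖divDiff f (z a) (z b) - divDiff f (lo (c a)) (z b)‖ ^ 2 ≤ 16 * L ^ 2 * E a b := by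
    intro a b hab hle
    obtain ⟨d, hdc, hd⟩ := hloa a
    rcases (hlen a).eq_or_lt with h | h
    · have : z a = lo (c a) := by
        simp only [len] at h
        linarith [hlz a, hzh a]
      rw [← this, sub_self, norm_zero, zero_pow two_ne_zero]
      exact mul_nonneg (by positivity) (hE0 a b)
    · simp only [E, h, hle, and_self, if_true]
      refine norm_sq_sub_le h (abs_nonneg _) (norm_nonneg _) ?_
      rw [← hd]
      refine norm_divDiff_sub_le hL (hf' _ _) (hf' _ _) (hf' _ _) ?_ ?_ ?_
      · exact fun h' => hab (le_antisymm (hc _ _ h'.le) (hc _ _ h'.ge))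
      · exact fun h' => hab (hdc.symm.trans (le_antisymm (hc _ _ h'.le) (hc _ _ h'.ge)))
      · rw [hd, abs_of_nonneg (sub_nonneg.2 (hlz a))]
        simp only [len]
        linarith [hzh a]
  have hnear : ∀ a b, c a = c b → ‖divDiff f (z a) (z b)‖ ^ 2 ≤ 16 * L ^ 2 * E a b := by
    intro a b hab
    have h1 := hlz a
    have h2 := hzh a
    have h3 := hlz b
    have h4 := hzh b
    rw [← hab] at h3 h4
    rcases (hlen a).eq_or_lt with h | h
    · have : z a = z b := by
        simp only [len] at h
        linarith
      rw [this, divDiff, sub_self, zero_div, norm_zero, zero_pow two_ne_zero]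
      exact mul_nonneg (by positivity) (hE0 a b)
    · have hle : len a ≤ len b := by simp only [len, hab, le_refl]
      simp only [E, h, hle, and_self, if_true]
      refine norm_sq_sub_le h (abs_nonneg _) (norm_nonneg _) ?_
      have h5 : |z a - z b| ≤ len a := abs_le.2 ⟨by simp only [len]; linarith,
        by simp only [len]; linarith⟩
      have h6 := norm_divDiff_le hL (hf' a b)
      calc _ ≤ L * (len a + len a) := by gcongr
        _ ≤ _ := by nlinarith
  let p : Fin (4 * m + 1) ⊕ Fin (4 * m + 1) → ι → ℂ := Sum.elim
    (fun k i => if c (.inl i) = k then (u i : ℂ) else 0)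
    (fun k i => if c (.inl i) ≠ k ∧ ¬ len (.inl i) ≤ hi k - lo k then
      divDiff f (x i) (lo k) * u i else 0)
  let q : Fin (4 * m + 1) ⊕ Fin (4 * m + 1) → κ → ℂ := Sum.elim
    (fun k j => if (k : ℕ) ≠ c (.inr j) ∧ hi k - lo k ≤ len (.inr j) then
      divDiff f (lo k) (y j) * v j else 0)
    (fun k j => if c (.inr j) = k then (v j : ℂ) else 0)
  have hpq : ∀ i j, ∑ k, p k i * q k j =
      if c (.inl i) = c (.inr j) then 0 else
        (if len (.inl i) ≤ len (.inr j) then divDiff f (lo (c (.inl i))) (y j)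
          else divDiff f (x i) (lo (c (.inr j)))) * (u i * v j) := by
    intro i j
    rw [Fintype.sum_sum_type, Fintype.sum_eq_single ⟨c (.inl i), hcm _⟩,
      Fintype.sum_eq_single ⟨c (.inr j), hcm _⟩]
    · by_cases h : c (.inl i) = c (.inr j)
      · simp [p, q, h]
      · by_cases h' : len (.inl i) ≤ len (.inr j)
        · have h'' : hi (c (.inl i)) - lo (c (.inl i)) ≤ len (.inr j) := h'
          have h3 : len (.inl i) ≤ hi (c (.inr j)) - lo (c (.inr j)) := h'
          simp only [p, q, Sum.elim_inl, Sum.elim_inr, ne_eq, h, h', h'', h3, not_false_eq_true,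
            not_true_eq_false, and_true, and_false, if_true, if_false]
          ring
        · have h'' : ¬ hi (c (.inl i)) - lo (c (.inl i)) ≤ len (.inr j) := h'
          have h3 : ¬ len (.inl i) ≤ hi (c (.inr j)) - lo (c (.inr j)) := h'
          simp only [p, q, Sum.elim_inl, Sum.elim_inr, ne_eq, h, h', h'', h3, not_false_eq_true,
            and_true, and_false, if_true, if_false]
          ring
    · intro k hk
      simp only [q, Sum.elim_inr]
      rw [if_neg (fun h => hk (Fin.ext h.symm)), mul_zero]
    · intro k hk
      simp only [p, Sum.elim_inl]
      rw [if_neg (fun h => hk (Fin.ext h.symm)), zero_mul]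
  have hterm : ∀ i j, ‖divDiff f (x i) (y j) * (u i * v j) - ∑ k, p k i * q k j‖ ^ 2 ≤
      16 * L ^ 2 * (u i ^ 2 * (v j ^ 2 * E (.inl i) (.inr j)) +
        v j ^ 2 * (u i ^ 2 * E (.inr j) (.inl i))) := by
    intro i j
    have key : ∀ D : ℂ, ‖D‖ ^ 2 ≤ 16 * L ^ 2 * (E (.inl i) (.inr j) + E (.inr j) (.inl i)) →
        ‖D * (u i * v j)‖ ^ 2 ≤ 16 * L ^ 2 * (u i ^ 2 * (v j ^ 2 * E (.inl i) (.inr j)) +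
        v j ^ 2 * (u i ^ 2 * E (.inr j) (.inl i))) := by
      intro D hD
      rw [norm_mul, norm_mul, Complex.norm_real, Complex.norm_real, mul_pow, mul_pow,
        Real.norm_eq_abs, Real.norm_eq_abs, sq_abs, sq_abs]
      calc _ ≤ _ := mul_le_mul_of_nonneg_right hD (by positivity)
        _ = _ := by ring
    have hE1 := mul_nonneg (by positivity : (0 : ℝ) ≤ 16 * L ^ 2) (hE0 (.inl i) (.inr j))
    have hE2 := mul_nonneg (by positivity : (0 : ℝ) ≤ 16 * L ^ 2) (hE0 (.inr j) (.inl i))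
    rw [hpq]
    split_ifs with h h'
    · rw [sub_zero]
      exact key _ ((hnear (.inl i) (.inr j) h).trans (by linarith))
    · rw [← sub_mul]
      exact key _ ((hfar (.inl i) (.inr j) h h').trans (by linarith))
    · rw [← sub_mul]
      refine key _ (le_trans (le_of_eq ?_)
        ((hfar (.inr j) (.inl i) (Ne.symm h) (le_of_not_ge h')).trans (by linarith)))
      rw [divDiff_comm f (x i), divDiff_comm f (x i)]
      rfl
  refine ⟨p, q, (Finset.sum_le_sum fun i _ => Finset.sum_le_sum fun j _ => hterm i j).trans ?_⟩
  have hS1 : ∀ i, ∑ j, v j ^ 2 * E (.inl i) (.inr j) ≤ 5 / m := fun i => by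
    refine le_trans ?_ (hEsum (.inl i))
    rw [Fintype.sum_sum_type]
    exact le_add_of_nonneg_left (Finset.sum_nonneg fun b _ => mul_nonneg (hw _) (hE0 _ _))
  have hS2 : ∀ j, ∑ i, u i ^ 2 * E (.inr j) (.inl i) ≤ 5 / m := fun j => by
    refine le_trans ?_ (hEsum (.inr j))
    rw [Fintype.sum_sum_type]
    exact le_add_of_nonneg_right (Finset.sum_nonneg fun b _ => mul_nonneg (hw _) (hE0 _ _))
  have hA : ∑ i, u i ^ 2 * ∑ j, v j ^ 2 * E (.inl i) (.inr j) ≤ 5 / m :=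
    calc _ ≤ ∑ i, u i ^ 2 * (5 / m) :=
          Finset.sum_le_sum fun i _ => mul_le_mul_of_nonneg_left (hS1 i) (sq_nonneg _)
      _ ≤ 5 / m := by
          rw [← Finset.sum_mul]
          exact mul_le_of_le_one_left (by positivity) hu
  have hB : ∑ j, v j ^ 2 * ∑ i, u i ^ 2 * E (.inr j) (.inl i) ≤ 5 / m :=
    calc _ ≤ ∑ j, v j ^ 2 * (5 / m) :=
          Finset.sum_le_sum fun i _ => mul_le_mul_of_nonneg_left (hS2 i) (sq_nonneg _)
      _ ≤ 5 / m := by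
          rw [← Finset.sum_mul]
          exact mul_le_of_le_one_left (by positivity) hv
  calc _ = 16 * L ^ 2 * (∑ i, u i ^ 2 * ∑ j, v j ^ 2 * E (.inl i) (.inr j) +
        ∑ j, v j ^ 2 * ∑ i, u i ^ 2 * E (.inr j) (.inl i)) := by
        simp_rw [← Finset.mul_sum, Finset.sum_add_distrib]
        congr 2
        · simp_rw [Finset.mul_sum]
        · rw [Finset.sum_comm]
          simp_rw [Finset.mul_sum]
    _ ≤ 16 * L ^ 2 * (5 / m + 5 / m) := by gcongr
    _ = 160 * L ^ 2 / m := by ring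

/-- The divided difference of a Lipschitz function is a Schur multiplier of norm `O(1 + log n)` on
matrices with at most `n` rows. -/
lemma norm_sum_mul_divDiff_le {ι κ : Type*} [Fintype ι] [Fintype κ] (x : ι → ℝ) (y : κ → ℝ)
    {f : ℝ → ℂ} {L : ℝ} (hL : 0 ≤ L)
    (hf : ∀ s ∈ Set.range x ∪ Set.range y, ∀ t ∈ Set.range x ∪ Set.range y,
      ‖f s - f t‖ ≤ L * |s - t|)
    (u : ι → ℝ) (v : κ → ℝ) (hu : ∑ i, u i ^ 2 ≤ 1) (hv : ∑ j, v j ^ 2 ≤ 1)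
    {n : ℕ} (hn : 0 < n) (hcard : Fintype.card ι ≤ n)
    {t : ι → κ → ℂ} {c : ℝ} (hc : 0 ≤ c)
    (ht : ∀ (p : ι → ℂ) (q : κ → ℂ),
      ‖∑ i, ∑ j, t i j * (p i * q j)‖ ≤ c * √(∑ i, ‖p i‖ ^ 2) * √(∑ j, ‖q j‖ ^ 2)) :
    ‖∑ i, ∑ j, t i j * (divDiff f (x i) (y j) * (u i * v j))‖ ≤
      200 * c * L * (1 + Real.log n) := by
  classical
  set M : ι → κ → ℂ := fun i j => divDiff f (x i) (y j) * (u i * v j) with hM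
  choose p q hpq using fun k : ℕ =>
    exists_lowRank_approx x y hL hf u v hu hv (m := 2 ^ k) (by positivity)
  set T : ℕ → ι → κ → ℂ := fun k i j => ∑ l, p k l i * q k l j with hT
  have hfac : ∀ {γ : Type} [Fintype γ] (N : ι → κ → ℂ) (P : γ → ι → ℂ) (Q : γ → κ → ℂ) (r h b : ℝ),
      (∀ i j, N i j = ∑ k, P k i * Q k j) → Fintype.card γ ≤ r → ∑ i, ∑ j, ‖N i j‖ ^ 2 ≤ h →
      0 ≤ b → r * h ≤ b ^ 2 → ‖∑ i, ∑ j, t i j * N i j‖ ≤ c * b := by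
    intro γ _ N P Q r h b hN hr hh hb hrh
    refine (norm_sum_mul_le_of_factorization hc ht P Q hN).trans ?_
    rw [mul_assoc, ← Real.sqrt_mul (Nat.cast_nonneg _)]
    refine mul_le_mul_of_nonneg_left ((Real.sqrt_le_left hb).2 (le_trans ?_ hrh)) hc
    have : 0 ≤ ∑ i, ∑ j, ‖N i j‖ ^ 2 := by positivity
    gcongr
    exact (Nat.cast_nonneg _).trans hr
  have hsq : ∀ N N' : ι → κ → ℂ, ∑ i, ∑ j, ‖N i j + N' i j‖ ^ 2 ≤
      2 * (∑ i, ∑ j, ‖N i j‖ ^ 2) + 2 * ∑ i, ∑ j, ‖N' i j‖ ^ 2 := by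
    intro N N'
    simp_rw [Finset.mul_sum, ← Finset.sum_add_distrib]
    refine Finset.sum_le_sum fun i _ => Finset.sum_le_sum fun j _ => ?_
    have h1 : ‖N i j + N' i j‖ ^ 2 ≤ (‖N i j‖ + ‖N' i j‖) ^ 2 := by
      gcongr
      exact norm_add_le _ _
    nlinarith [sq_nonneg (‖N i j‖ - ‖N' i j‖)]
  have hMT : ∀ k, ∑ i, ∑ j, ‖M i j - T k i j‖ ^ 2 ≤ 160 * L ^ 2 / 2 ^ k := fun k => by
    simpa only [Nat.cast_pow, Nat.cast_ofNat] using hpq k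
  have hTM : ∀ k, ∑ i, ∑ j, ‖T k i j - M i j‖ ^ 2 ≤ 160 * L ^ 2 / 2 ^ k := fun k => by
    simpa only [norm_sub_rev] using hMT k
  have hM1 : ∑ i, ∑ j, ‖M i j‖ ^ 2 ≤ L ^ 2 :=
    calc _ ≤ ∑ i, ∑ j, L ^ 2 * (u i ^ 2 * v j ^ 2) := by
          refine Finset.sum_le_sum fun i _ => Finset.sum_le_sum fun j _ => ?_
          have := norm_divDiff_le hL (hf (x i) (.inl ⟨i, rfl⟩) (y j) (.inr ⟨j, rfl⟩))
          rw [hM]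
          simp only
          rw [norm_mul, norm_mul, Complex.norm_real, Complex.norm_real, mul_pow, mul_pow,
            Real.norm_eq_abs, Real.norm_eq_abs, sq_abs, sq_abs]
          gcongr
      _ = L ^ 2 * ((∑ i, u i ^ 2) * ∑ j, v j ^ 2) := by
          rw [Finset.sum_mul_sum]
          simp_rw [Finset.mul_sum]
      _ ≤ L ^ 2 * (1 * 1) := by gcongr
      _ = L ^ 2 := by ring
  have h0 : ‖∑ i, ∑ j, t i j * T 0 i j‖ ≤ c * (57 * L) := by
    refine hfac (T 0) (p 0) (q 0) 10 (322 * L ^ 2) (57 * L) (fun _ _ => rfl) ?_ ?_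
      (by positivity) (by nlinarith [sq_nonneg L])
    · simp only [Fintype.card_sum, Fintype.card_fin]
      norm_num
    · have h1 := hsq (fun i j => T 0 i j - M i j) M
      have h2 := hTM 0
      simp only [sub_add_cancel, pow_zero, div_one] at h1 h2
      linarith
  have hstep : ∀ k, ‖∑ i, ∑ j, t i j * (T (k + 1) i j - T k i j)‖ ≤ c * (116 * L) := by
    intro k
    have h2k : (0 : ℝ) < 2 ^ k := by positivity
    have h2k1 : (1 : ℝ) ≤ 2 ^ k := one_le_pow₀ (by norm_num)
    refine hfac (fun i j => T (k + 1) i j - T k i j) (Sum.elim (p (k + 1)) (p k))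
      (Sum.elim (q (k + 1)) (fun l j => -q k l j)) (28 * 2 ^ k) (480 * L ^ 2 / 2 ^ k)
      (116 * L) ?_ ?_ ?_ (by positivity) ?_
    · intro i j
      simp [Fintype.sum_sum_type, hT, sub_eq_add_neg]
    · simp only [Fintype.card_sum, Fintype.card_fin]
      push_cast
      rw [pow_succ]
      linarith
    · have h1 := hsq (fun i j => T (k + 1) i j - M i j) (fun i j => M i j - T k i j)
      simp only [sub_add_sub_cancel] at h1
      have h2 := hTM (k + 1)
      have h3 := hMT k
      have h4 : 160 * L ^ 2 / 2 ^ (k + 1) = 80 * L ^ 2 / 2 ^ k := by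
        rw [pow_succ]
        field_simp
        ring
      have h5 : 480 * L ^ 2 / 2 ^ k = 2 * (80 * L ^ 2 / 2 ^ k) + 2 * (160 * L ^ 2 / 2 ^ k) := by
        ring
      rw [h5]
      linarith
    · rw [mul_div_assoc', mul_comm (28 : ℝ), mul_assoc, mul_div_cancel_left₀ _ h2k.ne']
      nlinarith [sq_nonneg L]
  obtain ⟨K, hK1, hK2⟩ : ∃ K : ℕ, n ≤ 2 ^ K ∧ (K : ℝ) ≤ 1 + 3 / 2 * Real.log n := by
    refine ⟨Nat.log 2 n + 1, (Nat.lt_pow_succ_log_self one_lt_two n).le, ?_⟩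
    have h1 : ((2 ^ Nat.log 2 n : ℕ) : ℝ) ≤ n := by
      exact_mod_cast Nat.pow_log_le_self 2 hn.ne'
    have h2 := Real.log_le_log (by positivity) h1
    rw [Nat.cast_pow, Real.log_pow] at h2
    have h3 := Real.log_two_gt_d9
    have h4 : (0 : ℝ) ≤ Nat.log 2 n := Nat.cast_nonneg _
    push_cast at h2 ⊢
    nlinarith
  have hlast : ‖∑ i, ∑ j, t i j * (M i j - T K i j)‖ ≤ c * (13 * L) := by
    let N : ι → κ → ℂ := fun i j => M i j - T K i j
    let e := Fintype.equivFin ι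
    refine hfac (γ := Fin (Fintype.card ι)) N (fun l i => if e i = l then 1 else 0)
      (fun l j => N (e.symm l) j) (2 ^ K) (160 * L ^ 2 / 2 ^ K) (13 * L) ?_ ?_ (hMT K)
      (by positivity) ?_
    · intro i j
      simp
    · rw [Fintype.card_fin]
      exact_mod_cast hcard.trans hK1
    · rw [mul_div_cancel₀ _ (by positivity)]
      nlinarith [sq_nonneg L]
  have htel : ∑ i, ∑ j, t i j * M i j = ∑ i, ∑ j, t i j * T 0 i j +
      ∑ k ∈ Finset.range K, ∑ i, ∑ j, t i j * (T (k + 1) i j - T k i j) +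
      ∑ i, ∑ j, t i j * (M i j - T K i j) := by
    have := Finset.sum_range_sub (fun k => ∑ i, ∑ j, t i j * T k i j) K
    simp only [mul_sub, Finset.sum_sub_distrib] at this ⊢
    rw [this]
    ring
  have hmid : ‖∑ k ∈ Finset.range K, ∑ i, ∑ j, t i j * (T (k + 1) i j - T k i j)‖ ≤
      K * (c * (116 * L)) := by
    simpa using norm_sum_le_of_le (Finset.range K) fun k _ => hstep k
  have hcL : 0 ≤ c * L := mul_nonneg hc hL
  have hlog : 0 ≤ Real.log n := Real.log_natCast_nonneg n
  calc _ ≤ c * (57 * L) + K * (c * (116 * L)) + c * (13 * L) := by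
        rw [htel]
        exact (norm_add₃_le).trans (by gcongr)
    _ ≤ 200 * c * L * (1 + Real.log n) := by
        nlinarith [mul_le_mul_of_nonneg_right hK2 hcL, mul_nonneg hcL hlog]

section Operators

variable {H : Type} [NormedAddCommGroup H] [InnerProductSpace ℂ H] [CompleteSpace H]

open scoped InnerProductSpace

lemma sum_norm_apply_sq {ι : Type*} [Fintype ι] {G : ι → H →L[ℂ] H}
    (hG : ∀ i, IsSelfAdjoint (G i)) (a : H) :
    ((∑ i, ‖G i a‖ ^ 2 : ℝ) : ℂ) = ⟪a, (∑ i, G i * G i) a⟫_ℂ := by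
  simp only [sum_apply, inner_sum, Complex.ofReal_sum]
  refine Finset.sum_congr rfl fun i _ => ?_
  rw [mul_apply_eq_comp, ← (hG i).isSymmetric.apply_clm a (G i a)]
  rw [inner_self_eq_norm_sq_to_K]
  simp

lemma sum_norm_apply_sq_le {ι : Type*} [Fintype ι] {G : ι → H →L[ℂ] H}
    (hG : ∀ i, IsSelfAdjoint (G i)) {c : ℝ} (h : ‖∑ i, G i * G i‖ ≤ c ^ 2) (a : H) :
    ∑ i, ‖G i a‖ ^ 2 ≤ (c * ‖a‖) ^ 2 := by
  have h0 : 0 ≤ ∑ i, ‖G i a‖ ^ 2 := by positivity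
  calc _ = ‖((∑ i, ‖G i a‖ ^ 2 : ℝ) : ℂ)‖ := by rw [Complex.norm_real, Real.norm_of_nonneg h0]
    _ ≤ ‖a‖ * ‖(∑ i, G i * G i) a‖ := by
        rw [sum_norm_apply_sq hG]
        exact norm_inner_le_norm _ _
    _ ≤ ‖a‖ * (c ^ 2 * ‖a‖) := by
        gcongr
        exact ContinuousLinearMap.le_of_opNorm_le _ h a
    _ = _ := by ring

lemma norm_sum_apply_le {ι : Type*} [Fintype ι] {G : ι → H →L[ℂ] H}
    (hG : ∀ i, IsSelfAdjoint (G i)) {c : ℝ} (hc : 0 ≤ c) (h : ‖∑ i, G i * G i‖ ≤ c ^ 2)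
    (η : ι → H) : ‖∑ i, G i (η i)‖ ≤ c * √(∑ i, ‖η i‖ ^ 2) := by
  set z := ∑ i, G i (η i) with hz
  have h1 : ‖z‖ * ‖z‖ ≤ (c * √(∑ i, ‖η i‖ ^ 2)) * ‖z‖ :=
    calc ‖z‖ * ‖z‖ = ‖⟪z, z⟫_ℂ‖ := by rw [inner_self_eq_norm_sq_to_K]; simp [sq]
      _ = ‖∑ i, ⟪η i, G i z⟫_ℂ‖ := by
          conv_lhs => rw [hz]
          rw [← hz, sum_inner]
          congr 1
          exact Finset.sum_congr rfl fun i _ => (hG i).isSymmetric.apply_clm _ _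
      _ ≤ ∑ i, ‖η i‖ * ‖G i z‖ := norm_sum_le_of_le _ fun i _ => norm_inner_le_norm _ _
      _ ≤ √(∑ i, ‖η i‖ ^ 2) * √(∑ i, ‖G i z‖ ^ 2) := Real.sum_mul_le_sqrt_mul_sqrt _ _ _
      _ ≤ √(∑ i, ‖η i‖ ^ 2) * (c * ‖z‖) := by
          gcongr
          exact (Real.sqrt_le_left (by positivity)).2 (sum_norm_apply_sq_le hG h z)
      _ = _ := by ring
  rcases (norm_nonneg z).eq_or_lt with h0 | h0
  · rw [← h0]
    positivity
  · exact le_of_mul_le_mul_right h1 h0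

lemma norm_sum_sub_inner_le {ι κ : Type*} [Fintype ι] [Fintype κ] {A B R : H →L[ℂ] H}
    (hA : IsSelfAdjoint A) (hR : ‖R‖ ≤ 1) {ε : ℝ} (hε : ‖A * R - R * B‖ ≤ ε)
    (x : ι → ℝ) (y : κ → ℝ) {φ : ι → H →L[ℂ] H} {ψ : κ → H →L[ℂ] H}
    (hφ : ∀ η : ι → H, ‖∑ i, φ i (η i)‖ ≤ √(∑ i, ‖η i‖ ^ 2))
    (hψ : ∀ η : κ → H, ‖∑ i, ψ i (η i)‖ ≤ √(∑ i, ‖η i‖ ^ 2))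
    (hφA : ∀ η : ι → H, ‖∑ i, (A (φ i (η i)) - (x i : ℂ) • φ i (η i))‖ ≤
      3 * ε * √(∑ i, ‖η i‖ ^ 2))
    (hψB : ∀ η : κ → H, ‖∑ i, (B (ψ i (η i)) - (y i : ℂ) • ψ i (η i))‖ ≤
      3 * ε * √(∑ i, ‖η i‖ ^ 2)) (ξ : ι → H) (ζ : κ → H) :
    ‖∑ i, ∑ j, ((x i - y j : ℝ) : ℂ) * ⟪φ i (ξ i), R (ψ j (ζ j))⟫_ℂ‖ ≤
      7 * ε * √(∑ i, ‖ξ i‖ ^ 2) * √(∑ j, ‖ζ j‖ ^ 2) := by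
  have hε0 : 0 ≤ ε := (norm_nonneg _).trans hε
  set X := ∑ i, φ i (ξ i) with hX
  set Z := ∑ j, ψ j (ζ j) with hZ
  set e₁ := ∑ i, (A (φ i (ξ i)) - (x i : ℂ) • φ i (ξ i)) with he₁
  set e₂ := ∑ j, (B (ψ j (ζ j)) - (y j : ℂ) • ψ j (ζ j)) with he₂
  have h1 : ∑ i, (x i : ℂ) • φ i (ξ i) = A X - e₁ := by
    rw [he₁, Finset.sum_sub_distrib, hX, map_sum]; abel
  have h2 : ∑ j, (y j : ℂ) • ψ j (ζ j) = B Z - e₂ := by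
    rw [he₂, Finset.sum_sub_distrib, hZ, map_sum]; abel
  have hid : ∑ i, ∑ j, ((x i - y j : ℝ) : ℂ) * ⟪φ i (ξ i), R (ψ j (ζ j))⟫_ℂ =
      ⟪X, (A * R - R * B) Z⟫_ℂ - ⟪e₁, R Z⟫_ℂ + ⟪X, R e₂⟫_ℂ := by
    have h3 : ∑ i, ∑ j, ((x i - y j : ℝ) : ℂ) * ⟪φ i (ξ i), R (ψ j (ζ j))⟫_ℂ =
        ⟪∑ i, (x i : ℂ) • φ i (ξ i), R Z⟫_ℂ - ⟪X, R (∑ j, (y j : ℂ) • ψ j (ζ j))⟫_ℂ := by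
      rw [Finset.sum_comm]
      simp only [hX, hZ, map_sum, sum_inner, Finset.mul_sum, inner_sum,
        ← Finset.sum_sub_distrib, map_smul, inner_smul_left, inner_smul_right, Complex.conj_ofReal, Complex.ofReal_sub, sub_mul]
    rw [h3, h1, h2, inner_sub_left, map_sub, inner_sub_right, sub_apply,
      inner_sub_right, mul_apply_eq_comp, mul_apply_eq_comp,
      hA.isSymmetric.apply_clm]
    ring
  have hRv : ∀ v, ‖R v‖ ≤ ‖v‖ := fun v => by simpa using R.le_of_opNorm_le hR v
  have hX' := hφ ξ
  have hZ' := hψ ζ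
  have h₁ := hφA ξ
  have h₂ := hψB ζ
  rw [← hX] at hX'
  rw [← hZ] at hZ'
  rw [← he₁] at h₁
  rw [← he₂] at h₂
  set a := √(∑ i, ‖ξ i‖ ^ 2)
  set b := √(∑ j, ‖ζ j‖ ^ 2)
  have ha : 0 ≤ a := Real.sqrt_nonneg _
  have hb : 0 ≤ b := Real.sqrt_nonneg _
  rw [hid]
  calc _ ≤ ‖⟪X, (A * R - R * B) Z⟫_ℂ‖ + ‖⟪e₁, R Z⟫_ℂ‖ + ‖⟪X, R e₂⟫_ℂ‖ :=
        (norm_add_le _ _).trans (by gcongr; exact norm_sub_le _ _)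
    _ ≤ a * (ε * b) + (3 * ε * a) * b + a * (3 * ε * b) := by
        gcongr
        · refine (norm_inner_le_norm _ _).trans ?_
          gcongr
          exact (ContinuousLinearMap.le_of_opNorm_le _ hε Z).trans (by gcongr)
        · refine (norm_inner_le_norm _ _).trans ?_
          gcongr
          exact (hRv Z).trans hZ'
        · refine (norm_inner_le_norm _ _).trans ?_
          gcongr
          exact (hRv e₂).trans h₂
    _ = _ := by ring

lemma norm_cfcC_le {A : H →L[ℂ] H} (hA : IsSelfAdjoint A) {g : ℝ → ℂ} {c : ℝ} (hc : 0 ≤ c)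
    (h : ∀ s ∈ spectrum ℝ A, ‖g s‖ ≤ c) : ‖cfcC g A‖ ≤ c := by
  refine norm_cfc_le hc fun z hz => h z.re ?_
  rw [hA.mem_spectrum_eq_re hz] at hz
  exact spectrum.of_algebraMap_mem ℂ hz

lemma cfcC_congr {A : H →L[ℂ] H} (hA : IsSelfAdjoint A) {g g' : ℝ → ℂ}
    (h : ∀ s ∈ spectrum ℝ A, g s = g' s) : cfcC g A = cfcC g' A := by
  refine cfc_congr fun z hz => h z.re ?_
  rw [hA.mem_spectrum_eq_re hz] at hz
  exact spectrum.of_algebraMap_mem ℂ hz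

lemma cfcC_mul {g g' : ℝ → ℂ} (hg : Continuous g) (hg' : Continuous g') (A : H →L[ℂ] H) :
    cfcC (fun s => g s * g' s) A = cfcC g A * cfcC g' A :=
  cfc_mul _ _ A (by fun_prop) (by fun_prop)

lemma cfcC_sub {g g' : ℝ → ℂ} (hg : Continuous g) (hg' : Continuous g') (A : H →L[ℂ] H) :
    cfcC (fun s => g s - g' s) A = cfcC g A - cfcC g' A :=
  cfc_sub _ _ A (by fun_prop) (by fun_prop)

lemma cfcC_sum {ι : Type*} [Fintype ι] {g : ι → ℝ → ℂ} (hg : ∀ i, Continuous (g i))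
    (A : H →L[ℂ] H) : cfcC (fun s => ∑ i, g i s) A = ∑ i, cfcC (g i) A := by
  have := cfc_sum_univ (fun i (z : ℂ) => g i z.re) A
    (fun i => ((hg i).comp Complex.continuous_re).continuousOn)
  rw [Finset.sum_fn] at this
  exact this

lemma cfcC_const {A : H →L[ℂ] H} (hA : IsSelfAdjoint A) (r : ℂ) :
    cfcC (fun _ => r) A = r • 1 := by
  rw [cfcC, cfc_const r A hA.isStarNormal, Algebra.algebraMap_eq_smul_one]

lemma cfcC_ofReal {A : H →L[ℂ] H} (hA : IsSelfAdjoint A) : cfcC (fun s => (s : ℂ)) A = A := by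
  conv_rhs => rw [← cfc_id ℂ A hA.isStarNormal]
  exact cfc_congr fun z hz => (hA.mem_spectrum_eq_re hz).symm

lemma isSelfAdjoint_cfcC (g : ℝ → ℝ) (A : H →L[ℂ] H) :
    IsSelfAdjoint (cfcC (fun s => (g s : ℂ)) A) := by
  rw [cfcC, IsSelfAdjoint, ← cfc_star]
  simp

/-- A quadratic partition of unity in `A`, subordinate to a `2ε`-net of the spectrum. -/
lemma exists_partition_of_net {A : H →L[ℂ] H} (hA : IsSelfAdjoint A) {ι : Type*} [Fintype ι]
    {x : ι → ℝ} (hx : ∀ i, x i ∈ spectrum ℝ A) {ε : ℝ} (hε : 0 < ε)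
    (hcov : ∀ s ∈ spectrum ℝ A, ∃ i, |s - x i| ≤ 2 * ε) :
    ∃ φ : ι → H →L[ℂ] H, (∀ i, IsSelfAdjoint (φ i)) ∧ ∑ i, φ i * φ i = 1 ∧
      (∀ η : ι → H, ‖∑ i, (A (φ i (η i)) - (x i : ℂ) • φ i (η i))‖ ≤
        3 * ε * √(∑ i, ‖η i‖ ^ 2)) ∧
      ∀ (f : ℝ → ℂ) (L : ℝ), Continuous f → 0 ≤ L →
        (∀ s ∈ spectrum ℝ A, ∀ t ∈ spectrum ℝ A, ‖f s - f t‖ ≤ L * |s - t|) →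
        ‖cfcC f A - ∑ i, f (x i) • (φ i * φ i)‖ ≤ 3 * ε * L := by
  let g : ι → ℝ → ℝ := fun i s => max 0 (3 * ε - |s - x i|)
  have hgc : ∀ i, Continuous (g i) := fun i => by fun_prop
  let N : ℝ → ℝ := fun s => max (ε ^ 2) (∑ i, g i s ^ 2)
  have hNpos : ∀ s, 0 < N s := fun s => lt_max_of_lt_left (by positivity)
  have hNc : Continuous N := by fun_prop
  have hN : ∀ s ∈ spectrum ℝ A, N s = ∑ i, g i s ^ 2 := by
    intro s hs
    refine max_eq_right ?_
    obtain ⟨i, hi⟩ := hcov s hs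
    have : ε ≤ g i s := le_max_of_le_right (by linarith)
    calc ε ^ 2 ≤ g i s ^ 2 := by gcongr
      _ ≤ _ := Finset.single_le_sum (f := fun i => g i s ^ 2) (fun i _ => sq_nonneg _)
          (Finset.mem_univ i)
  let h : ι → ℝ → ℝ := fun i s => g i s / √(N s)
  have hsqrt : ∀ s, √(N s) ≠ 0 := fun s => (Real.sqrt_pos.2 (hNpos s)).ne'
  have hhc : ∀ i, Continuous (h i) := fun i => (hgc i).div (by fun_prop) hsqrt
  have hhC : ∀ i, Continuous fun s => (h i s : ℂ) := fun i => Complex.continuous_ofReal.comp (hhc i)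
  have hhC2 : ∀ i, Continuous fun s => (h i s : ℂ) * h i s := fun i => (hhC i).mul (hhC i)
  have hsum : ∀ s ∈ spectrum ℝ A, ∑ i, h i s ^ 2 = 1 := by
    intro s hs
    simp only [h, div_pow, Real.sq_sqrt (hNpos s).le]
    rw [← Finset.sum_div, ← hN s hs, div_self (hNpos s).ne']
  have hsupp : ∀ i s, h i s ≠ 0 → |s - x i| ≤ 3 * ε := by
    intro i s hne
    by_contra! hlt
    exact hne (by simp only [h, g]; rw [max_eq_left (by linarith), zero_div])
  refine ⟨fun i => cfcC (fun s => (h i s : ℂ)) A, fun i => isSelfAdjoint_cfcC _ _, ?_, ?_, ?_⟩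
  · simp_rw [← cfcC_mul (hhC _) (hhC _)]
    rw [← cfcC_sum hhC2, ← one_smul ℂ (1 : H →L[ℂ] H), ← cfcC_const hA]
    refine cfcC_congr hA fun s hs => ?_
    have := hsum s hs
    simp_rw [← sq]
    exact_mod_cast this
  · intro η
    let k : ι → ℝ → ℝ := fun i s => (s - x i) * h i s
    have hkc : ∀ i, Continuous fun s => (k i s : ℂ) := fun i =>
      Complex.continuous_ofReal.comp (by fun_prop)
    have hkC2 : ∀ i, Continuous fun s => (k i s : ℂ) * k i s := fun i => (hkc i).mul (hkc i)
    have hk : ∀ i v, A (cfcC (fun s => (h i s : ℂ)) A v) - (x i : ℂ) • cfcC (fun s => (h i s : ℂ)) A v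
        = cfcC (fun s => (k i s : ℂ)) A v := by
      intro i v
      have : cfcC (fun s => (k i s : ℂ)) A = (A - (x i : ℂ) • 1) * cfcC (fun s => (h i s : ℂ)) A := by
        rw [← cfcC_const hA]
        nth_rw 2 [← cfcC_ofReal hA]
        rw [← cfcC_sub Complex.continuous_ofReal continuous_const,
          ← cfcC_mul (by fun_prop) (hhC i)]
        simp only [k, Complex.ofReal_mul, Complex.ofReal_sub]
      rw [this]
      simp
    simp only [hk]
    refine norm_sum_apply_le (fun i => isSelfAdjoint_cfcC _ _) (by positivity) ?_ η
    simp_rw [← cfcC_mul (hkc _) (hkc _)]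
    rw [← cfcC_sum hkC2]
    refine norm_cfcC_le hA (by positivity) fun s hs => ?_
    simp_rw [← sq, ← Complex.ofReal_pow]
    rw [← Complex.ofReal_sum, Complex.norm_real, Real.norm_of_nonneg (by positivity)]
    calc ∑ i, k i s ^ 2 ≤ ∑ i, (3 * ε) ^ 2 * h i s ^ 2 := by
          refine Finset.sum_le_sum fun i _ => ?_
          rw [mul_pow (s - x i)]
          by_cases hi : h i s = 0
          · simp [hi]
          · exact mul_le_mul_of_nonneg_right (sq_le_sq.2 ((hsupp i s hi).trans (le_abs_self _)))
              (sq_nonneg _)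
      _ = _ := by rw [← Finset.mul_sum, hsum s hs, mul_one]
  · intro f L hf hL hLip
    have hhC3 : ∀ i, Continuous fun s => f (x i) * ((h i s : ℂ) * h i s) := fun i =>
      continuous_const.mul (hhC2 i)
    have hhC4 : Continuous fun s => ∑ i, f (x i) * ((h i s : ℂ) * h i s) :=
      continuous_finsetSum _ fun i _ => hhC3 i
    have : ∑ i, f (x i) • (cfcC (fun s => (h i s : ℂ)) A * cfcC (fun s => (h i s : ℂ)) A) =
        cfcC (fun s => ∑ i, f (x i) * ((h i s : ℂ) * h i s)) A := by
      rw [cfcC_sum hhC3]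
      refine Finset.sum_congr rfl fun i _ => ?_
      rw [cfcC_mul continuous_const (hhC2 i), cfcC_const hA,
        cfcC_mul (hhC i) (hhC i), smul_one_mul]
    rw [this, ← cfcC_sub hf hhC4]
    refine norm_cfcC_le hA (by positivity) fun s hs => ?_
    have h1 : f s - ∑ i, f (x i) * ((h i s : ℂ) * h i s) =
        ∑ i, (f s - f (x i)) * ((h i s ^ 2 : ℝ) : ℂ) := by
      simp_rw [sub_mul, Finset.sum_sub_distrib, ← Finset.mul_sum]
      rw [← Complex.ofReal_sum, hsum s hs]
      simp [sq]
    rw [h1]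
    calc _ ≤ ∑ i, 3 * ε * L * h i s ^ 2 := by
          refine norm_sum_le_of_le _ fun i _ => ?_
          rw [norm_mul, Complex.norm_real, Real.norm_of_nonneg (sq_nonneg _)]
          by_cases hi : h i s = 0
          · simp [hi]
          · gcongr
            refine (hLip s hs _ (hx i)).trans ?_
            rw [mul_comm]
            gcongr
            exact hsupp i s hi
      _ = _ := by rw [← Finset.mul_sum, hsum s hs, mul_one]

lemma divDiff_mul_sub (f : ℝ → ℂ) (s t : ℝ) : divDiff f s t * ((s - t : ℝ) : ℂ) = f s - f t := by
  rw [divDiff]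
  rcases eq_or_ne s t with rfl | h
  · simp
  · exact div_mul_cancel₀ _ (by exact_mod_cast _root_.sub_ne_zero.2 h)

lemma norm_sum_partition_comm_le {ι κ : Type*} [Fintype ι] [Fintype κ] {A B R : H →L[ℂ] H}
    (hA : IsSelfAdjoint A) (hR : ‖R‖ ≤ 1) {ε : ℝ} (hε : ‖A * R - R * B‖ ≤ ε)
    (x : ι → ℝ) (y : κ → ℝ) {φ : ι → H →L[ℂ] H} {ψ : κ → H →L[ℂ] H}
    (hφ : ∀ i, IsSelfAdjoint (φ i)) (hψ : ∀ j, IsSelfAdjoint (ψ j))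
    (hφ1 : ∑ i, φ i * φ i = 1) (hψ1 : ∑ j, ψ j * ψ j = 1)
    (hφA : ∀ η : ι → H, ‖∑ i, (A (φ i (η i)) - (x i : ℂ) • φ i (η i))‖ ≤
      3 * ε * √(∑ i, ‖η i‖ ^ 2))
    (hψB : ∀ η : κ → H, ‖∑ i, (B (ψ i (η i)) - (y i : ℂ) • ψ i (η i))‖ ≤
      3 * ε * √(∑ i, ‖η i‖ ^ 2))
    {f : ℝ → ℂ} {L : ℝ} (hL : 0 ≤ L)
    (hf : ∀ s ∈ Set.range x ∪ Set.range y, ∀ t ∈ Set.range x ∪ Set.range y,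
      ‖f s - f t‖ ≤ L * |s - t|) {n : ℕ} (hn : 0 < n) (hcard : Fintype.card ι ≤ n) :
    ‖(∑ i, f (x i) • (φ i * φ i)) * R - R * ∑ j, f (y j) • (ψ j * ψ j)‖ ≤
      1400 * (1 + Real.log n) * L * ε := by
  have hε0 : 0 ≤ ε := (norm_nonneg _).trans hε
  have hlog : 0 ≤ Real.log n := Real.log_natCast_nonneg n
  have h1le : ‖(1 : H →L[ℂ] H)‖ ≤ 1 ^ 2 := by
    rw [one_pow]
    exact ContinuousLinearMap.norm_id_le
  set T := (∑ i, f (x i) • (φ i * φ i)) * R - R * ∑ j, f (y j) • (ψ j * ψ j) with hT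
  have hTsum : T = ∑ i, ∑ j, (f (x i) - f (y j)) • (φ i * φ i * R * (ψ j * ψ j)) := by
    have h1 : (∑ i, f (x i) • (φ i * φ i)) * R =
        (∑ i, f (x i) • (φ i * φ i)) * R * ∑ j, ψ j * ψ j := by rw [hψ1, mul_one]
    have h2 : R * ∑ j, f (y j) • (ψ j * ψ j) =
        (∑ i, φ i * φ i) * R * ∑ j, f (y j) • (ψ j * ψ j) := by rw [hφ1, one_mul]
    rw [hT, h1, h2]
    simp only [Finset.sum_mul, Finset.mul_sum, sub_smul, Finset.sum_sub_distrib, smul_mul_assoc,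
      mul_smul_comm, Finset.smul_sum]
    congr 1
    · exact Finset.sum_comm
    · exact Finset.sum_comm
  have key : ∀ a b : H, ‖a‖ ≤ 1 → ‖b‖ ≤ 1 → ‖⟪b, T a⟫_ℂ‖ ≤ 1400 * (1 + Real.log n) * L * ε := by
    intro a b ha hb
    have hu : ∑ i, ‖φ i b‖ ^ 2 ≤ 1 := (sum_norm_apply_sq_le hφ (hφ1 ▸ h1le) b).trans
      (by rw [one_mul]; exact pow_le_one₀ (norm_nonneg _) hb)
    have hv : ∑ j, ‖ψ j a‖ ^ 2 ≤ 1 := (sum_norm_apply_sq_le hψ (hψ1 ▸ h1le) a).trans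
      (by rw [one_mul]; exact pow_le_one₀ (norm_nonneg _) ha)
    let b' : ι → H := fun i => ((‖φ i b‖ : ℂ)⁻¹) • φ i b
    let a' : κ → H := fun j => ((‖ψ j a‖ : ℂ)⁻¹) • ψ j a
    have hunit : ∀ w : H, ‖((‖w‖ : ℂ)⁻¹) • w‖ ≤ 1 := fun w => by
      rw [norm_smul, norm_inv, Complex.norm_real, norm_norm]
      exact inv_mul_le_one
    have hsmul : ∀ w : H, (‖w‖ : ℂ) • ((‖w‖ : ℂ)⁻¹ • w) = w := fun w => by
      rcases eq_or_ne w 0 with rfl | hw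
      · simp
      · exact smul_inv_smul₀ (by simpa using hw) w
    let t : ι → κ → ℂ := fun i j => ((x i - y j : ℝ) : ℂ) * ⟪φ i (b' i), R (ψ j (a' j))⟫_ℂ
    have ht : ∀ (p : ι → ℂ) (q : κ → ℂ), ‖∑ i, ∑ j, t i j * (p i * q j)‖ ≤
        7 * ε * √(∑ i, ‖p i‖ ^ 2) * √(∑ j, ‖q j‖ ^ 2) := by
      intro p q
      have h1 := norm_sum_sub_inner_le hA hR hε x y
        (fun η => by simpa using norm_sum_apply_le hφ zero_le_one (hφ1 ▸ h1le) η)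
        (fun η => by simpa using norm_sum_apply_le hψ zero_le_one (hψ1 ▸ h1le) η)
        hφA hψB (fun i => (starRingEnd ℂ (p i)) • b' i) (fun j => q j • a' j)
      calc _ = ‖∑ i, ∑ j, ((x i - y j : ℝ) : ℂ) * ⟪φ i ((starRingEnd ℂ (p i)) • b' i),
              R (ψ j (q j • a' j))⟫_ℂ‖ := by
            congr 1
            refine Finset.sum_congr rfl fun i _ => Finset.sum_congr rfl fun j _ => ?_
            simp only [t, map_smul, inner_smul_left, inner_smul_right, Complex.conj_conj]
            ring
        _ ≤ _ := h1
        _ ≤ _ := by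
            gcongr with i _ j _
            · rw [norm_smul, RCLike.norm_conj]
              exact mul_le_of_le_one_right (norm_nonneg _) (hunit _)
            · rw [norm_smul]
              exact mul_le_of_le_one_right (norm_nonneg _) (hunit _)
    have hmain := norm_sum_mul_divDiff_le x y hL hf (fun i => ‖φ i b‖) (fun j => ‖ψ j a‖) hu hv hn
      hcard (by positivity : 0 ≤ 7 * ε) ht
    calc ‖⟪b, T a⟫_ℂ‖ = ‖∑ i, ∑ j, t i j * (divDiff f (x i) (y j) *
          ((‖φ i b‖ : ℂ) * (‖ψ j a‖ : ℂ)))‖ := by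
          congr 1
          rw [hTsum]
          simp only [sum_apply, inner_sum]
          refine Finset.sum_congr rfl fun i _ => Finset.sum_congr rfl fun j _ => ?_
          have e1 : ⟪b, ((f (x i) - f (y j)) • (φ i * φ i * R * (ψ j * ψ j))) a⟫_ℂ =
              (f (x i) - f (y j)) * ⟪φ i (φ i b), R (ψ j (ψ j a))⟫_ℂ := by
            simp only [smul_apply, inner_smul_right, mul_apply_eq_comp]
            rw [(hφ i).isSymmetric.apply_clm, (hφ i).isSymmetric.apply_clm]
          rw [e1, ← divDiff_mul_sub]
          conv_lhs => rw [← hsmul (φ i b), ← hsmul (ψ j a)]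
          simp only [t, b', a', map_smul, inner_smul_left, inner_smul_right, Complex.conj_ofReal]
          ring
      _ ≤ _ := hmain
      _ = _ := by ring
  refine ContinuousLinearMap.opNorm_le_of_unit_norm (by positivity) fun a ha => ?_
  rcases eq_or_ne (T a) 0 with h0 | h0
  · rw [h0, norm_zero]
    positivity
  have h2 := key a ((‖T a‖ : ℂ)⁻¹ • T a) ha.le (by
    rw [norm_smul, norm_inv, Complex.norm_real, norm_norm]
    exact inv_mul_le_one)
  rwa [inner_smul_left, norm_mul, RCLike.norm_conj, norm_inv, Complex.norm_real, norm_norm,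
    inner_self_eq_norm_sq_to_K, norm_pow, RCLike.norm_ofReal, abs_norm, sq,
    inv_mul_cancel_left₀ (norm_ne_zero_iff.2 h0)] at h2

lemma norm_cfcC_mul_sub_le {ι κ : Type*} [Fintype ι] [Fintype κ] {A B R : H →L[ℂ] H}
    (hA : IsSelfAdjoint A) (hB : IsSelfAdjoint B) (hR : ‖R‖ ≤ 1) {ε : ℝ} (hε0 : 0 < ε)
    (hε : ‖A * R - R * B‖ ≤ ε) {x : ι → ℝ} (hx : ∀ i, x i ∈ spectrum ℝ A)
    (hxcov : ∀ s ∈ spectrum ℝ A, ∃ i, |s - x i| ≤ 2 * ε)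
    {y : κ → ℝ} (hy : ∀ j, y j ∈ spectrum ℝ B)
    (hycov : ∀ s ∈ spectrum ℝ B, ∃ j, |s - y j| ≤ 2 * ε)
    {f : ℝ → ℂ} (hfc : Continuous f) {L : ℝ} (hL : 0 ≤ L)
    (hf : ∀ s ∈ spectrum ℝ A ∪ spectrum ℝ B, ∀ t ∈ spectrum ℝ A ∪ spectrum ℝ B,
      ‖f s - f t‖ ≤ L * |s - t|) {n : ℕ} (hn : 0 < n) (hcard : Fintype.card ι ≤ n) :
    ‖cfcC f A * R - R * cfcC f B‖ ≤ 1406 * (1 + Real.log n) * L * ε := by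
  obtain ⟨φ, hφ, hφ1, hφA, hφf⟩ := exists_partition_of_net hA hx hε0 hxcov
  obtain ⟨ψ, hψ, hψ1, hψB, hψf⟩ := exists_partition_of_net hB hy hε0 hycov
  have h1 := hφf f L hfc hL fun s hs t ht => hf s (.inl hs) t (.inl ht)
  have h2 := hψf f L hfc hL fun s hs t ht => hf s (.inr hs) t (.inr ht)
  have hrange : Set.range x ∪ Set.range y ⊆ spectrum ℝ A ∪ spectrum ℝ B :=
    Set.union_subset_union (Set.range_subset_iff.2 hx) (Set.range_subset_iff.2 hy)
  have h3 := norm_sum_partition_comm_le hA hR hε x y hφ hψ hφ1 hψ1 hφA hψB hL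
    (fun s hs t ht => hf s (hrange hs) t (hrange ht)) hn hcard
  set X := ∑ i, f (x i) • (φ i * φ i)
  set Y := ∑ j, f (y j) • (ψ j * ψ j)
  have hlog : 0 ≤ Real.log n := Real.log_natCast_nonneg n
  calc ‖cfcC f A * R - R * cfcC f B‖
      = ‖(cfcC f A - X) * R + (X * R - R * Y) - R * (cfcC f B - Y)‖ := by
        congr 1
        rw [sub_mul, mul_sub]
        abel
    _ ≤ ‖cfcC f A - X‖ * ‖R‖ + ‖X * R - R * Y‖ + ‖R‖ * ‖cfcC f B - Y‖ := by
        refine (norm_sub_le _ _).trans (add_le_add ((norm_add_le _ _).trans ?_) (norm_mul_le _ _))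
        gcongr
        exact norm_mul_le _ _
    _ ≤ 3 * ε * L * 1 + 1400 * (1 + Real.log n) * L * ε + 1 * (3 * ε * L) := by gcongr
    _ ≤ _ := by
        have : 0 ≤ Real.log n * (L * ε) := by positivity
        linarith

lemma IsCompact.exists_finite_net {S : Set ℝ} (hS : IsCompact S) {ε : ℝ} (hε : 0 < ε) :
    ∃ t : Finset ℝ, (∀ y ∈ t, y ∈ S) ∧ ∀ s ∈ S, ∃ y ∈ t, |s - y| ≤ 2 * ε := by
  obtain ⟨t, htS, htfin, hcov⟩ := hS.finite_cover_balls hε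
  refine ⟨htfin.toFinset, fun y hy => htS (htfin.mem_toFinset.1 hy), fun s hs => ?_⟩
  obtain ⟨y, hy, hsy⟩ := Set.mem_iUnion₂.1 (hcov hs)
  rw [Metric.mem_ball, Real.dist_eq] at hsy
  exact ⟨y, htfin.mem_toFinset.2 hy, by linarith⟩

lemma exists_finite_net_of_subset_iUnion_Icc {S : Set ℝ} {Λ : Finset ℝ} {ε : ℝ}
    (h : S ⊆ ⋃ t ∈ Λ, Set.Icc (t - ε) (t + ε)) :
    ∃ t : Finset ℝ, t.card ≤ Λ.card ∧ (∀ x ∈ t, x ∈ S) ∧ ∀ s ∈ S, ∃ x ∈ t, |s - x| ≤ 2 * ε := by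
  classical
  let P : ℝ → Prop := fun t => ∃ s ∈ S, |s - t| ≤ ε
  let g : ℝ → ℝ := fun t => if ht : P t then ht.choose else 0
  have hg : ∀ t, P t → g t ∈ S ∧ |g t - t| ≤ ε := fun t ht => by
    simp only [g, dif_pos ht]
    exact ht.choose_spec
  refine ⟨(Λ.filter P).image g, Finset.card_image_le.trans (Finset.card_filter_le _ _), ?_, ?_⟩
  · intro x hx
    obtain ⟨t, ht, rfl⟩ := Finset.mem_image.1 hx
    exact (hg t (Finset.mem_filter.1 ht).2).1
  · intro s hs
    obtain ⟨t, ht, hst⟩ := Set.mem_iUnion₂.1 (h hs)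
    have hst' : |s - t| ≤ ε := abs_le.2 ⟨by linarith [hst.1], by linarith [hst.2]⟩
    have hPt : P t := ⟨s, hs, hst'⟩
    refine ⟨g t, Finset.mem_image_of_mem g (Finset.mem_filter.2 ⟨ht, hPt⟩), ?_⟩
    calc |s - g t| ≤ |s - t| + |t - g t| := abs_sub_le _ _ _
      _ ≤ ε + ε := by
          rw [abs_sub_comm t]
          exact add_le_add hst' (hg t hPt).2
      _ = _ := by ring

end Operators

theorem stmt16 :
    ∃ C : ℝ, 0 < C ∧
      ∀ (H : Type) [NormedAddCommGroup H] [InnerProductSpace ℂ H] [CompleteSpace H]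
        (A B R : H →L[ℂ] H), IsSelfAdjoint A → IsSelfAdjoint B → ‖R‖ ≤ 1 →
        0 < ‖A * R - R * B‖ →
        ∀ F : Set ℝ, IsClosed F → spectrum ℝ A ⊆ F →
        ∀ Λ : Finset ℝ, Λ.Nonempty →
          (F ⊆ ⋃ t ∈ Λ, Set.Icc (t - ‖A * R - R * B‖) (t + ‖A * R - R * B‖)) →
          ∀ L : ℝ, 0 ≤ L →
          ∀ f : ℝ → ℂ, Continuous f →
            (∀ x ∈ F ∪ spectrum ℝ B, ∀ y ∈ F ∪ spectrum ℝ B,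
              ‖f x - f y‖ ≤ L * |x - y|) →
            ‖cfcC f A * R - R * cfcC f B‖ ≤
              C * (1 + Real.log Λ.card) * L * ‖A * R - R * B‖ := by
  refine ⟨1406, by norm_num, ?_⟩
  intro H _ _ _ A B R hA hB hR hε F _ hAF Λ hΛ hcov L hL f hfc hf
  obtain ⟨s, hscard, hs, hsnet⟩ := exists_finite_net_of_subset_iUnion_Icc (hAF.trans hcov)
  obtain ⟨t, ht, htnet⟩ := (spectrum.isCompact (𝕜 := ℝ) B).exists_finite_net hε
  refine norm_cfcC_mul_sub_le hA hB hR hε le_rfl (x := ((↑) : s → ℝ)) (fun i => hs _ i.2) ?_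
    (y := ((↑) : t → ℝ)) (fun j => ht _ j.2) ?_ hfc hL ?_ hΛ.card_pos (by simpa using hscard)
  · intro r hr
    obtain ⟨p, hp, hrp⟩ := hsnet r hr
    exact ⟨⟨p, hp⟩, hrp⟩
  · intro r hr
    obtain ⟨p, hp, hrp⟩ := htnet r hr
    exact ⟨⟨p, hp⟩, hrp⟩
  · exact fun r hr p hp => hf r (Set.union_subset_union_left _ hAF hr) p
      (Set.union_subset_union_left _ hAF hp)
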